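/- There is no function f₃ : ℝ³ → ℝ that is measurable and integrable on [0,1]³ and satisfies all four of the following requirements: (i) symmetry in the first two arguments: f₃(x₁,x₂,x₃) = f₃(x₂,x₁,x₃) for all x₁,x₂,x₃ ∈ [0,1]; (ii) nonnegativity: f₃(x₁,x₂,x₃) ≥ 0 for all x₁,x₂,x₃ ∈ [0,1]; (iii) vanishing where f₂ vanishes: for all x₁,x₂ ∈ [0,1], if f₂(x₁,x₂) = 0 then f₃(x₁,x₂,x₃) = 0 for all x₃ ∈ [0,1]; (iv) consistency: f₂(x₁,x₂) = ∫₀¹ f₃(x₁,x₃,x₂) dx₃ for all x₁,x₂ ∈ [0,1]. (This is the concrete counterexample establishing the paper's Proposition: no truncation ansatz f₃ = F[f₁,f₂] can simultaneously satisfy the symmetry, positivity, vanishing, and consistency requirements.) -/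

import Mathlib

open MeasureTheory

/-- The domain Ω from the paper: a diamond with a square hole removed. -/
def Omega : Set (ℝ × ℝ) :=
  {p : ℝ × ℝ | |p.1 - 1/2| + |p.2 - 1/2| < 1/2} \
    {p : ℝ × ℝ | |p.1 - 1/2| < 1/4 ∧ |p.2 - 1/2| < 1/4}

/-- The two-particle distribution `f₂ = 4 χ_Ω`. -/
noncomputable def f₂ (x₁ x₂ : ℝ) : ℝ :=
  4 * Omega.indicator (fun _ => (1 : ℝ)) (x₁, x₂)

lemma f2_measurable_left (z : ℝ) : Measurable (fun x => f₂ x z) := by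
  have hO : MeasurableSet Omega := by
    unfold Omega
    apply MeasurableSet.diff
    · exact measurableSet_lt (by fun_prop) (by fun_prop)
    · have a1 : MeasurableSet {p : ℝ × ℝ | |p.1 - 1/2| < 1/4} :=
        measurableSet_lt (by fun_prop) (by fun_prop)
      have a2 : MeasurableSet {p : ℝ × ℝ | |p.2 - 1/2| < 1/4} :=
        measurableSet_lt (by fun_prop) (by fun_prop)
      exact a1.inter a2
  unfold f₂
  exact ((measurable_const.indicator hO).comp (by fun_prop : Measurable fun x : ℝ => (x, z))).const_mul 4

lemma f2_eq_zero {x y : ℝ} : f₂ x y = 0 ↔ (x, y) ∉ Omega := by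
  unfold f₂
  by_cases h : (x, y) ∈ Omega <;> simp [h]

lemma not_all_Omega {x y z : ℝ} (h1 : (x, y) ∈ Omega) (h2 : (x, z) ∈ Omega)
    (h3 : (y, z) ∈ Omega) : False := by
  simp only [Omega, Set.mem_sdiff, Set.mem_ofPred_eq, not_and, not_lt] at h1 h2 h3
  obtain ⟨a1, b1⟩ := h1
  obtain ⟨a2, b2⟩ := h2
  obtain ⟨a3, b3⟩ := h3
  rcases lt_or_ge |x - 1/2| (1/4) with hx | hx
  · have := b1 hx
    have := b2 hx
    linarith
  · rcases lt_or_ge |y - 1/2| (1/4) with hy | hy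
    · have := b3 hy
      linarith
    · linarith

lemma mem_Omega_box {x z : ℝ} (hx : x ∈ Set.Ioo (13/16 : ℝ) (14/16))
    (hz : z ∈ Set.Ioo (7/16 : ℝ) (9/16)) : (x, z) ∈ Omega := by
  obtain ⟨h1, h2⟩ := hx
  obtain ⟨h3, h4⟩ := hz
  have e1 : |x - 1/2| = x - 1/2 := abs_of_pos (by linarith)
  have e2 : |z - 1/2| < 1/16 := abs_lt.2 ⟨by linarith, by linarith⟩
  simp only [Omega, Set.mem_sdiff, Set.mem_ofPred_eq, not_and, not_lt]
  rw [e1]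
  exact ⟨by linarith, fun h => by linarith⟩

lemma exists_of_ae {P : ℝ → Prop} {a b : ℝ} (hab : a < b) (ha : 0 ≤ a) (hb : b ≤ 1)
    (h : ∀ᵐ x ∂(volume.restrict (Set.Icc (0:ℝ) 1)), P x) : ∃ x ∈ Set.Ioo a b, P x := by
  have hs : Set.Ioo a b ⊆ Set.Icc (0:ℝ) 1 :=
    fun x hx => ⟨ha.trans hx.1.le, hx.2.le.trans hb⟩
  have h' : ∀ᵐ x ∂(volume.restrict (Set.Ioo a b)), P x := ae_restrict_of_ae_restrict_of_subset hs h
  have hm : ∀ᵐ x ∂(volume.restrict (Set.Ioo a b)), x ∈ Set.Ioo a b :=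
    ae_restrict_mem measurableSet_Ioo
  have : NeZero (volume.restrict (Set.Ioo a b)) := ⟨by
    rw [Ne, Measure.restrict_eq_zero, Real.volume_Ioo]
    simp [hab]⟩
  obtain ⟨x, hx⟩ := (hm.and h').exists
  exact ⟨x, hx⟩

/-- There is no measurable, integrable `f₃` on `[0,1]³` satisfying symmetry in the first
two arguments, nonnegativity, vanishing where `f₂` vanishes, and the consistency
requirement `f₂(x₁,x₂) = ∫₀¹ f₃(x₁,x₃,x₂) dx₃`. -/
theorem no_truncation_ansatz :
    ¬ ∃ f₃ : ℝ × ℝ × ℝ → ℝ,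
      Measurable f₃ ∧
      IntegrableOn f₃ (Set.Icc 0 1 ×ˢ Set.Icc 0 1 ×ˢ Set.Icc 0 1) ∧
      (∀ x₁ ∈ Set.Icc (0:ℝ) 1, ∀ x₂ ∈ Set.Icc (0:ℝ) 1, ∀ x₃ ∈ Set.Icc (0:ℝ) 1,
        f₃ (x₁, x₂, x₃) = f₃ (x₂, x₁, x₃)) ∧
      (∀ x₁ ∈ Set.Icc (0:ℝ) 1, ∀ x₂ ∈ Set.Icc (0:ℝ) 1, ∀ x₃ ∈ Set.Icc (0:ℝ) 1,
        0 ≤ f₃ (x₁, x₂, x₃)) ∧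
      (∀ x₁ ∈ Set.Icc (0:ℝ) 1, ∀ x₂ ∈ Set.Icc (0:ℝ) 1, f₂ x₁ x₂ = 0 →
        ∀ x₃ ∈ Set.Icc (0:ℝ) 1, f₃ (x₁, x₂, x₃) = 0) ∧
      (∀ x₁ ∈ Set.Icc (0:ℝ) 1, ∀ x₂ ∈ Set.Icc (0:ℝ) 1,
        f₂ x₁ x₂ = ∫ x₃ in Set.Icc (0:ℝ) 1, f₃ (x₁, x₃, x₂)) := by
  rintro ⟨f, hf, hi, hsym, hpos, hvan, hcon⟩
  set μ : Measure ℝ := volume.restrict (Set.Icc (0:ℝ) 1) with hμ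
  have hI : ∀ᵐ x ∂μ, x ∈ Set.Icc (0:ℝ) 1 := ae_restrict_mem measurableSet_Icc
  have hi' : Integrable f (μ.prod (μ.prod μ)) := by
    rw [hμ, Measure.prod_restrict, Measure.prod_restrict]
    exact hi
  have hmp : MeasurePreserving (fun p : ℝ × ℝ × ℝ => (p.2.1, p.2.2, p.1))
      (μ.prod (μ.prod μ)) (μ.prod (μ.prod μ)) :=
    (measurePreserving_prodAssoc μ μ μ).comp Measure.measurePreserving_swap
  have hG : Integrable (fun p : ℝ × ℝ × ℝ => f (p.2.1, p.2.2, p.1)) (μ.prod (μ.prod μ)) :=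
    hmp.integrable_comp_of_integrable hi'
  obtain ⟨z, hz, hzint⟩ := exists_of_ae (a := 7/16) (b := 9/16) (by norm_num) (by norm_num)
    (by norm_num) hG.prod_right_ae
  have hzI : z ∈ Set.Icc (0:ℝ) 1 := ⟨by linarith [hz.1], by linarith [hz.2]⟩
  have hfz : Measurable (fun p : ℝ × ℝ => f (p.1, p.2, z)) := hf.comp (by fun_prop)
  have h1 : ∀ᵐ x ∂μ, ∀ᵐ y ∂μ, f₂ x z = 0 → f (x, y, z) = 0 := by
    filter_upwards [hzint.prod_right_ae, hI] with x hx hxI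
    by_cases h0 : f₂ x z = 0
    · have h00 := hcon x hxI z hzI
      rw [h0] at h00
      have hnn : 0 ≤ᵐ[μ] fun y => f (x, y, z) := by
        filter_upwards [hI] with y hy using hpos x hxI y hy z hzI
      have := (integral_eq_zero_iff_of_nonneg_ae hnn hx).1 h00.symm
      filter_upwards [this] with y hy _ using hy
    · exact Filter.Eventually.of_forall fun y h => absurd h h0
  have hms : MeasurableSet {p : ℝ × ℝ | f₂ p.1 z = 0 → f (p.1, p.2, z) = 0} := by
    have a1 : MeasurableSet {p : ℝ × ℝ | f₂ p.1 z = 0} :=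
      ((f2_measurable_left z).comp measurable_fst) (measurableSet_singleton 0)
    have a2 : MeasurableSet {p : ℝ × ℝ | f (p.1, p.2, z) = 0} := hfz (measurableSet_singleton 0)
    exact a1.imp a2
  have h2 : ∀ᵐ p ∂(μ.prod μ), f₂ p.1 z = 0 → f (p.1, p.2, z) = 0 :=
    (Measure.ae_prod_iff_ae_ae hms).2 h1
  have h3 : ∀ᵐ p ∂(μ.prod μ), f₂ p.2 z = 0 → f (p.2, p.1, z) = 0 :=
    (Measure.measurePreserving_swap (μ := μ) (ν := μ)).quasiMeasurePreserving.ae h2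
  obtain ⟨x, hx, hx3, hx1⟩ := exists_of_ae (a := 13/16) (b := 14/16) (by norm_num) (by norm_num)
    (by norm_num) ((Measure.ae_ae_of_ae_prod h3).and h1)
  have hxI : x ∈ Set.Icc (0:ℝ) 1 := ⟨by linarith [hx.1], by linarith [hx.2]⟩
  have hxz := mem_Omega_box hx hz
  have hzero : (fun y => f (x, y, z)) =ᵐ[μ] fun _ => (0:ℝ) := by
    filter_upwards [hx3, hI] with y hy hyI
    by_cases hxy : (x, y) ∈ Omega
    · by_cases hyz : (y, z) ∈ Omega
      · exact (not_all_Omega hxy hxz hyz).elim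
      · rw [hsym x hxI y hyI z hzI]
        exact hy (f2_eq_zero.2 hyz)
    · exact hvan x hxI y hyI (f2_eq_zero.2 hxy) z hzI
  have h4 := hcon x hxI z hzI
  rw [integral_congr_ae hzero, integral_zero] at h4
  exact f2_eq_zero.1 h4 hxz
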